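/- (Abstract core of Theorem 5.5 on confluence via the unraveling transformation U.) Let A and B be binary relations on a set T. Assume: (i) A is terminating; (ii) A ⊆ B* (every A-step s A t implies s B* t); (iii) every A-normal form is a B-normal form; and (iv) B is confluent. Then A is confluent. -/

import Mathlib

open Relation in
/-- For a terminating relation, every element reduces to a normal form. -/
theorem exists_reflTransGen_normalForm {T : Type*} {A : T → T → Prop}
    (hterm : WellFounded (fun a b => A b a)) (a : T) :
    ∃ n, ReflTransGen A a n ∧ ∀ b, ¬ A n b := by
  induction a using hterm.induction with
  | _ a ih =>
    by_cases h : ∃ b, A a b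
    · obtain ⟨b, hab⟩ := h
      obtain ⟨n, hbn, hn⟩ := ih b hab
      exact ⟨n, .head hab hbn, hn⟩
    · exact ⟨a, .refl, not_exists.mp h⟩

open Relation in
/-- A normal form reduces only to itself. -/
theorem eq_of_reflTransGen_normalForm {T : Type*} {B : T → T → Prop} {a b : T}
    (ha : ∀ c, ¬ B a c) (h : ReflTransGen B a b) : a = b := by
  rcases h.cases_head with rfl | ⟨c, hac, -⟩
  · rfl
  · exact absurd hac (ha c)

/-- Abstract core of Theorem 5.5 (confluence via the unraveling transformation `U`):
let `A` and `B` be binary relations on a set `T`.  If (i) `A` is terminating (its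
converse is well-founded), (ii) every `A`-step is included in `B*`, (iii) every
`A`-normal form is a `B`-normal form, and (iv) `B` is confluent, then `A` is
confluent. -/
theorem confluence_via_transformation {T : Type*} (A B : T → T → Prop)
    (hterm : WellFounded (fun a b => A b a))
    (hsub : ∀ s t, A s t → Relation.ReflTransGen B s t)
    (hnf : ∀ a, (∀ b, ¬ A a b) → (∀ b, ¬ B a b))
    (hconf : ∀ a b c, Relation.ReflTransGen B a b → Relation.ReflTransGen B a c →
      ∃ d, Relation.ReflTransGen B b d ∧ Relation.ReflTransGen B c d) :
    ∀ a b c, Relation.ReflTransGen A a b → Relation.ReflTransGen A a c →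
      ∃ d, Relation.ReflTransGen A b d ∧ Relation.ReflTransGen A c d := by
  intro a b c hab hac
  have lift {s t : T} (h : Relation.ReflTransGen A s t) : Relation.ReflTransGen B s t :=
    Relation.reflTransGen_closed hsub _ _ h
  obtain ⟨m, hbm, hm⟩ := exists_reflTransGen_normalForm hterm b
  obtain ⟨n, hcn, hn⟩ := exists_reflTransGen_normalForm hterm c
  obtain ⟨d, hmd, hnd⟩ := hconf a m n (lift (hab.trans hbm)) (lift (hac.trans hcn))
  obtain rfl := eq_of_reflTransGen_normalForm (hnf m hm) hmd
  obtain rfl := eq_of_reflTransGen_normalForm (hnf n hn) hnd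
  exact ⟨_, hbm, hcn⟩
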